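/- arXiv:1801.09040 — 5 statements merged into one kernel-verified Lean document; each statement's English description precedes it below -/
import Mathlib

section
/- Let f : (0,1) → (0,∞) be differentiable and antitone (decreasing), integrable on (0,1). Let φ : (0,1) → [0,∞), and suppose there are A > 0 and δ₀ ∈ (0,1) such that for every open interval I ⊆ (0,1) with 0 < |I| ≤ δ₀, (1/|I|)∫_I |f − f_I| ≤ A·φ(|I|). Let ψ : (0,1] → [0,∞) be essentially increasing, i.e. there is c₀ ≥ 1 with ψ(x) ≤ c₀·ψ(y) whenever 0 < x ≤ y ≤ 1, and suppose there are c₁ > 0 and δ₁ ∈ (0,1) such that x·|f′(x)| ≥ c₁·ψ(x) for all x ∈ (0,δ₁). Then there exist C > 0 and δ₂ > 0 such that ψ(x) ≤ C·φ(4x) for all x ∈ (0,δ₂). -/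
open MeasureTheory Set

/-- A lower bound for a nonnegative integrable function on a subinterval bounds its integral. -/
theorem mul_length_le_setIntegral_Ioo {h : ℝ → ℝ} {a b p q g : ℝ}
    (hint : IntegrableOn h (Ioo a b)) (hnonneg : ∀ y, 0 ≤ h y)
    (hap : a ≤ p) (hpq : p ≤ q) (hqb : q ≤ b) (hg : ∀ y ∈ Ioo p q, g ≤ h y) :
    (q - p) * g ≤ ∫ y in Ioo a b, h y := by
  have hsub : Ioo p q ⊆ Ioo a b := Ioo_subset_Ioo hap hqb
  calc (q - p) * g = ∫ _ in Ioo p q, g := by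
        simp [Measure.real, ENNReal.toReal_ofReal (sub_nonneg.2 hpq)]
    _ ≤ ∫ y in Ioo p q, h y :=
        setIntegral_mono_on (integrableOn_const measure_Ioo_lt_top.ne) (hint.mono_set hsub)
          measurableSet_Ioo hg
    _ ≤ ∫ y in Ioo a b, h y :=
        setIntegral_mono_set hint (Filter.Eventually.of_forall hnonneg) hsub.eventuallyLE

/-- For an antitone function, a lower bound on `|deriv f|` bounds the decrease from below. -/
theorem AntitoneOn.mul_sub_le_sub_of_le_abs_deriv {f : ℝ → ℝ} {s : Set ℝ} {a b g : ℝ}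
    (hanti : AntitoneOn f s) (hs : Icc a b ⊆ s) (hab : a < b)
    (hdiff : ∀ y ∈ Icc a b, DifferentiableAt ℝ f y)
    (hg : ∀ y ∈ Ioo a b, g ≤ |deriv f y|) : g * (b - a) ≤ f a - f b := by
  obtain ⟨ξ, hξ, h⟩ := exists_deriv_eq_slope f hab
    (fun y hy => (hdiff y hy).continuousAt.continuousWithinAt)
    (fun y hy => (hdiff y (Ioo_subset_Icc_self hy)).differentiableWithinAt)
  have hba : 0 < b - a := sub_pos.2 hab
  have hle : f b ≤ f a :=
    hanti (hs (left_mem_Icc.2 hab.le)) (hs (right_mem_Icc.2 hab.le)) hab.le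
  have hgξ := hg ξ hξ
  rwa [h, abs_div, abs_of_pos hba, abs_of_nonpos (sub_nonpos.2 hle), neg_sub,
    le_div_iff₀ hba] at hgξ

/-- Lemma A.3 (1): an oscillation bound forces an upper bound on
any essentially increasing lower bound for `x |f'(x)|`. -/
theorem stmt_5 (f φ ψ : ℝ → ℝ) (A c₀ c₁ δ₀ δ₁ : ℝ)
    (hf_pos : ∀ x ∈ Set.Ioo (0 : ℝ) 1, 0 < f x)
    (hf_diff : ∀ x ∈ Set.Ioo (0 : ℝ) 1, DifferentiableAt ℝ f x)
    (hf_anti : AntitoneOn f (Set.Ioo 0 1))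
    (hf_int : IntegrableOn f (Set.Ioo 0 1))
    (hφ : ∀ x ∈ Set.Ioo (0 : ℝ) 1, 0 ≤ φ x)
    (hA : 0 < A) (hδ₀ : δ₀ ∈ Set.Ioo (0 : ℝ) 1)
    (hosc : ∀ a b : ℝ, 0 ≤ a → b ≤ 1 → a < b → b - a ≤ δ₀ →
      ⨍ x in Set.Ioo a b, |f x - ⨍ y in Set.Ioo a b, f y| ≤ A * φ (b - a))
    (hψ : ∀ x ∈ Set.Ioc (0 : ℝ) 1, 0 ≤ ψ x)
    (hc₀ : 1 ≤ c₀)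
    (hess : ∀ x y : ℝ, 0 < x → x ≤ y → y ≤ 1 → ψ x ≤ c₀ * ψ y)
    (hc₁ : 0 < c₁) (hδ₁ : δ₁ ∈ Set.Ioo (0 : ℝ) 1)
    (hder : ∀ x ∈ Set.Ioo (0 : ℝ) δ₁, c₁ * ψ x ≤ x * |deriv f x|) :
    ∃ C > (0 : ℝ), ∃ δ₂ > (0 : ℝ), ∀ x ∈ Set.Ioo (0 : ℝ) δ₂, ψ x ≤ C * φ (4 * x) := by
  have hc₀' : 0 < c₀ := by linarith
  refine ⟨12 * c₀ * A / c₁, by positivity, min δ₀ δ₁ / 4,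
    div_pos (lt_min hδ₀.1 hδ₁.1) (by norm_num), fun x hx => ?_⟩
  obtain ⟨hx0, hx4⟩ := hx
  have hxδ₀ : 4 * x < δ₀ := by linarith [min_le_left δ₀ δ₁]
  have hxδ₁ : 4 * x < δ₁ := by linarith [min_le_right δ₀ δ₁]
  have hδ₀1 := hδ₀.2
  set g := c₁ * ψ x / (3 * c₀) with hg
  have hderiv : ∀ y ∈ Ioo x (3 * x), g / x ≤ |deriv f y| := by
    intro y hy
    have hy0 : 0 < y := hx0.trans hy.1
    have h1 := hder y ⟨hy0, by linarith [hy.2]⟩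
    have h2 := hess x y hx0 hy.1.le (by linarith [hy.2])
    have h3 : y * |deriv f y| ≤ 3 * x * |deriv f y| :=
      mul_le_mul_of_nonneg_right hy.2.le (abs_nonneg _)
    have h4 : c₁ * ψ x ≤ c₁ * (c₀ * ψ y) := mul_le_mul_of_nonneg_left h2 hc₁.le
    have h5 : c₀ * (c₁ * ψ y) ≤ c₀ * (3 * x * |deriv f y|) :=
      mul_le_mul_of_nonneg_left (h1.trans h3) hc₀'.le
    rw [hg, div_div, div_le_iff₀ (by positivity)]
    linarith
  have hgap : ∀ a, x ≤ a → a + x ≤ 3 * x → g ≤ f a - f (a + x) := by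
    intro a ha hb
    have hsub : Icc a (a + x) ⊆ Ioo 0 1 := fun y hy =>
      ⟨by linarith [hy.1], by linarith [hy.2]⟩
    have h := hf_anti.mul_sub_le_sub_of_le_abs_deriv hsub (by linarith)
      (fun y hy => hf_diff y (hsub hy))
      (fun y hy => hderiv y ⟨by linarith [hy.1], by linarith [hy.2]⟩)
    rwa [add_sub_cancel_left, div_mul_cancel₀ _ hx0.ne'] at h
  have hosc' := hosc 0 (4 * x) le_rfl (by linarith) (by linarith) (by linarith)
  set m := ⨍ y in Ioo 0 (4 * x), f y
  have hint : IntegrableOn (fun y => |f y - m|) (Ioo 0 (4 * x)) :=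
    ((hf_int.mono_set (Ioo_subset_Ioo_right (by linarith))).sub
      (integrableOn_const measure_Ioo_lt_top.ne)).abs
  have hlow : x * g ≤ ∫ y in Ioo 0 (4 * x), |f y - m| := by
    rcases le_total m (f (2 * x)) with hm | hm
    · have h := mul_length_le_setIntegral_Ioo (g := g) hint (fun _ => abs_nonneg _)
        le_rfl hx0.le (by linarith) (fun y hy => by
          have h1 := hgap x le_rfl (by linarith)
          have h2 := hf_anti ⟨hy.1, by linarith [hy.2]⟩ ⟨hx0, by linarith⟩ hy.2.le
          rw [← two_mul] at h1
          exact le_trans (by linarith) (le_abs_self _))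
      rwa [sub_zero] at h
    · have h := mul_length_le_setIntegral_Ioo (g := g) (p := 3 * x) hint
        (fun _ => abs_nonneg _) (by linarith) (by linarith) le_rfl (fun y hy => by
          have h1 := hgap (2 * x) (by linarith) (by linarith)
          have h2 := hf_anti ⟨by linarith, by linarith⟩
            ⟨by linarith [hy.1], by linarith [hy.2]⟩ hy.1.le
          rw [show 2 * x + x = 3 * x by ring] at h1
          exact le_trans (by linarith) (neg_le_abs _))
      rwa [show 4 * x - 3 * x = x by ring] at h
  rw [setAverage_eq, Real.volume_real_Ioo_of_le (by linarith), sub_zero, smul_eq_mul,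
    inv_mul_le_iff₀ (by positivity)] at hosc'
  have hgφ : g ≤ 4 * (A * φ (4 * x)) := by
    refine le_of_mul_le_mul_left (hlow.trans (hosc'.trans_eq ?_)) hx0
    ring
  rw [hg, div_le_iff₀ (by positivity)] at hgφ
  rw [div_mul_eq_mul_div, le_div_iff₀ hc₁]
  linarith
end

section
/- Let f : (0,1) → (0,∞) be differentiable, antitone (decreasing), integrable on (0,1), and convex on (0,δ₁) for some δ₁ ∈ (0,1). Let φ : (0,1) → [0,∞), and suppose there are A > 0 and δ₀ ∈ (0,1) such that for every open interval I ⊆ (0,1) with 0 < |I| ≤ δ₀, (1/|I|)∫_I |f − f_I| ≤ A·φ(|I|). Then there exist C > 0 and δ₂ > 0 such that x·|f′(x)| ≤ C·φ(x) for all x ∈ (0,δ₂). -/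
open MeasureTheory Set

/-- On an interval `(0, x)` where every chord of `f` has slope at most `-m`, the integral of
`|f - c|` is at least `m * x ^ 2 / 6`, whatever the constant `c`. -/
theorem mul_sq_le_integral_abs_sub_of_chord_le {f : ℝ → ℝ} {x m : ℝ} (c : ℝ) (hx : 0 < x)
    (hf : IntegrableOn f (Ioo 0 x))
    (hchord : ∀ u v, 0 < u → u < v → v < x → m * (v - u) ≤ f u - f v) :
    m * x ^ 2 / 6 ≤ ∫ y in Ioo 0 x, |f y - c| := by
  have hfin : volume (Ioo 0 x) ≠ ⊤ := by simp
  have habs : IntegrableOn (fun y ↦ |f y - c|) (Ioo 0 x) :=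
    (hf.sub (integrableOn_const hfin)).abs
  have hpoly : ∫ y in Ioo 0 x, (m * (x / 2 - y) ^ 2 + (f (x / 2) - c) * (x / 2 - y))
      = m * x ^ 3 / 12 := by
    rw [← integral_Ioc_eq_integral_Ioo, ← intervalIntegral.integral_of_le hx.le,
      intervalIntegral.integral_comp_sub_left
        (fun t ↦ m * t ^ 2 + (f (x / 2) - c) * t) (x / 2),
      intervalIntegral.integral_add (Continuous.intervalIntegrable (by fun_prop) _ _)
        (Continuous.intervalIntegrable (by fun_prop) _ _),
      intervalIntegral.integral_const_mul, intervalIntegral.integral_const_mul,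
      integral_pow, integral_id]
    push_cast
    ring
  have hcont : Continuous fun y ↦ m * (x / 2 - y) ^ 2 + (f (x / 2) - c) * (x / 2 - y) := by
    fun_prop
  have hle : ∫ y in Ioo 0 x, (m * (x / 2 - y) ^ 2 + (f (x / 2) - c) * (x / 2 - y))
      ≤ ∫ y in Ioo 0 x, x / 2 * |f y - c| := by
    refine setIntegral_mono_on (hcont.integrableOn_Icc.mono_set Ioo_subset_Icc_self)
      (habs.const_mul _) measurableSet_Ioo fun y hy ↦ ?_
    have htangent : m * (x / 2 - y) ^ 2 ≤ (f y - f (x / 2)) * (x / 2 - y) := by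
      rcases lt_trichotomy y (x / 2) with h | h | h
      · nlinarith [hchord y (x / 2) hy.1 h (by linarith)]
      · simp [h]
      · nlinarith [hchord (x / 2) y (by linarith) h hy.2]
    have hprod : (f y - c) * (x / 2 - y) ≤ x / 2 * |f y - c| := by
      calc (f y - c) * (x / 2 - y) ≤ |f y - c| * |x / 2 - y| := by
            rw [← abs_mul]; exact le_abs_self _
        _ ≤ |f y - c| * (x / 2) := by
            gcongr
            exact abs_le.2 ⟨by linarith [hy.2], by linarith [hy.1]⟩
        _ = x / 2 * |f y - c| := mul_comm _ _
    linarith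
  rw [hpoly, integral_const_mul] at hle
  refine le_of_mul_le_mul_left ?_ (half_pos hx)
  linarith

/-- A chord of a convex function lying to the left of `x` has slope at most `deriv f x`. -/
theorem ConvexOn.sub_le_deriv_mul_sub {s : Set ℝ} {f : ℝ → ℝ} (hf : ConvexOn ℝ s f)
    {u v x : ℝ} (hu : u ∈ s) (hx : x ∈ s) (huv : u < v) (hvx : v < x)
    (hd : DifferentiableAt ℝ f x) : f v - f u ≤ deriv f x * (v - u) := by
  have hv : v ∈ s := hf.1.ordConnected.out hu hx ⟨huv.le, hvx.le⟩
  have h₁ := hf.slope_mono_adjacent hu hx huv hvx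
  have h₂ := hf.slope_le_deriv hv hx hvx hd
  rw [slope_def_field] at h₂
  exact (div_le_iff₀ (sub_pos.2 huv)).1 (h₁.trans h₂)

/-- Lemma A.3 (2): for a decreasing convex singular profile, the
oscillation bound implies `x |f'(x)| ≲ φ(x)` near `0`. -/
theorem stmt_6 (f φ : ℝ → ℝ) (A δ₀ δ₁ : ℝ)
    (hf_pos : ∀ x ∈ Set.Ioo (0 : ℝ) 1, 0 < f x)
    (hf_diff : ∀ x ∈ Set.Ioo (0 : ℝ) 1, DifferentiableAt ℝ f x)
    (hf_anti : AntitoneOn f (Set.Ioo 0 1))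
    (hf_int : IntegrableOn f (Set.Ioo 0 1))
    (hδ₁ : δ₁ ∈ Set.Ioo (0 : ℝ) 1)
    (hf_conv : ConvexOn ℝ (Set.Ioo 0 δ₁) f)
    (hφ : ∀ x ∈ Set.Ioo (0 : ℝ) 1, 0 ≤ φ x)
    (hA : 0 < A) (hδ₀ : δ₀ ∈ Set.Ioo (0 : ℝ) 1)
    (hosc : ∀ a b : ℝ, 0 ≤ a → b ≤ 1 → a < b → b - a ≤ δ₀ →
      ⨍ x in Set.Ioo a b, |f x - ⨍ y in Set.Ioo a b, f y| ≤ A * φ (b - a)) :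
    ∃ C > (0 : ℝ), ∃ δ₂ > (0 : ℝ), ∀ x ∈ Set.Ioo (0 : ℝ) δ₂,
      x * |deriv f x| ≤ C * φ x := by
  refine ⟨6 * A, by positivity, min δ₀ δ₁, lt_min hδ₀.1 hδ₁.1, fun x hx ↦ ?_⟩
  have hx₀ : x < δ₀ := hx.2.trans_le (min_le_left _ _)
  have hx₁ : x < δ₁ := hx.2.trans_le (min_le_right _ _)
  have hx1 : x ∈ Ioo (0 : ℝ) 1 := ⟨hx.1, hx₁.trans hδ₁.2⟩
  have hderiv : deriv f x ≤ 0 := by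
    rw [← derivWithin_of_isOpen isOpen_Ioo hx1]
    exact hf_anti.derivWithin_nonpos
  have hlow := mul_sq_le_integral_abs_sub_of_chord_le (m := -deriv f x)
    (⨍ y in Ioo 0 x, f y) hx.1 (hf_int.mono_set (Ioo_subset_Ioo_right hx1.2.le))
    fun u v hu huv hvx ↦ by
      linarith [hf_conv.sub_le_deriv_mul_sub ⟨hu, (huv.trans hvx).trans hx₁⟩ ⟨hx.1, hx₁⟩ huv hvx
        (hf_diff x hx1)]
  have hup := hosc 0 x le_rfl hx1.2.le hx.1 (by linarith)
  rw [setAverage_eq, sub_zero, smul_eq_mul, Real.volume_real_Ioo_of_le hx.1.le, sub_zero,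
    inv_mul_le_iff₀ hx.1] at hup
  rw [abs_of_nonpos hderiv]
  refine le_of_mul_le_mul_left ?_ hx.1
  linarith
end

section
/- Let k ≥ 1 be an integer, φ_*(x) = ln^{[k]}(|ln x|) and φ(x) = −x·(d/dx)φ_*(x) for small x > 0. Then for every N > 0 and every δ ∈ (0,1) there exist a smooth compactly supported function f : ℝ → ℝ with supp f ⊆ [−1,1] and a nonempty open interval I with 0 < |I| < δ such that (1/|I|)∫_I |φ_*(M f) − (φ_*(M f))_I| > N·φ(|I|). In other words, no constant C can satisfy the Coifman–Rochberg-type bound ⨍_I |φ_*(Mf) − (φ_*(Mf))_I| ≤ C·φ(|I|) uniformly over all such f and all small intervals I. -/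
open MeasureTheory Set

/-- The uncentered Hardy–Littlewood maximal function over bounded intervals. -/
noncomputable def maxFun1 (g : ℝ → ℝ) (x : ℝ) : ℝ :=
  sSup {A | ∃ a b : ℝ, a < b ∧ x ∈ Set.Ioo a b ∧ A = ⨍ y in Set.Ioo a b, |g y|}

/-- `φ_*(x) = ln^{[k]} |ln x|`. -/
noncomputable def phiStar (k : ℕ) (x : ℝ) : ℝ := Real.log^[k] |Real.log x|

/-- `φ(x) = -x (φ_*)'(x)`. -/
noncomputable def phiW (k : ℕ) (x : ℝ) : ℝ := -x * deriv (phiStar k) x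

open Filter Topology

theorem tendsto_iterate_log_atTop (k : ℕ) : Tendsto (Real.log^[k]) atTop atTop :=
  Real.tendsto_log_atTop.iterate k

theorem exists_hasDerivAt_iterate_log (k : ℕ) : ∃ d : ℝ → ℝ, Tendsto d atTop (𝓝 0) ∧
    ∀ᶠ t in atTop, HasDerivAt (Real.log^[k + 1]) (d t) t := by
  induction k with
  | zero =>
    refine ⟨fun t => t⁻¹, tendsto_inv_atTop_zero, ?_⟩
    filter_upwards [eventually_gt_atTop 0] with t ht
    simpa using Real.hasDerivAt_log ht.ne'
  | succ k ih =>
    obtain ⟨d, hd, hderiv⟩ := ih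
    refine ⟨fun t => d t / Real.log^[k + 1] t,
      hd.div_atTop (tendsto_iterate_log_atTop (k + 1)), ?_⟩
    filter_upwards [hderiv, (tendsto_iterate_log_atTop (k + 1)).eventually_gt_atTop 0]
      with t ht hpos
    rw [Function.iterate_succ' Real.log (k + 1)]
    exact ht.log hpos.ne'

theorem tendsto_phiW_zero {k : ℕ} (hk : 1 ≤ k) : Tendsto (phiW k) (𝓝[>] 0) (𝓝 0) := by
  obtain ⟨k, rfl⟩ := Nat.exists_eq_add_of_le' hk
  obtain ⟨d, hd, hderiv⟩ := exists_hasDerivAt_iterate_log k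
  have hlog : Tendsto (fun x => -Real.log x) (𝓝[>] 0) atTop :=
    tendsto_neg_atBot_atTop.comp Real.tendsto_log_nhdsGT_zero
  refine (hd.comp hlog).congr' ?_
  filter_upwards [hlog.eventually hderiv, Ioo_mem_nhdsGT (zero_lt_one (α := ℝ))] with x hx hx1
  have hEq : phiStar (k + 1) =ᶠ[𝓝 x] fun y => Real.log^[k + 1] (-Real.log y) := by
    filter_upwards [isOpen_Ioo.mem_nhds hx1] with y hy
    simp only [phiStar, abs_of_neg (Real.log_neg hy.1 hy.2)]
  have h := (hx.comp x (Real.hasDerivAt_log hx1.1.ne').neg).congr_of_eventuallyEq hEq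
  rw [phiW, h.deriv]
  have := hx1.1.ne'
  simp only [Function.comp_apply]
  field_simp

theorem exists_strictMonoOn_iterate_log (k : ℕ) :
    ∃ E : ℝ, StrictMonoOn (Real.log^[k]) (Ici E) := by
  induction k with
  | zero => exact ⟨0, strictMono_id.strictMonoOn _⟩
  | succ k ih =>
    obtain ⟨E, hE⟩ := ih
    refine ⟨Real.exp E, fun x hx y hy hxy => ?_⟩
    have hx0 : 0 < x := (Real.exp_pos E).trans_le hx
    have hy0 : 0 < y := (Real.exp_pos E).trans_le hy
    exact hE ((Real.le_log_iff_exp_le hx0).2 hx) ((Real.le_log_iff_exp_le hy0).2 hy)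
      (Real.log_lt_log hx0 hxy)

theorem exists_strictMonoOn_phiStar (k : ℕ) :
    ∃ E : ℝ, 0 < E ∧ StrictMonoOn (phiStar k) (Ici E) := by
  obtain ⟨E, hE⟩ := exists_strictMonoOn_iterate_log k
  refine ⟨Real.exp (max E 0), Real.exp_pos _, fun x hx y hy hxy => ?_⟩
  have hx0 : 0 < x := (Real.exp_pos _).trans_le hx
  have hy0 : 0 < y := (Real.exp_pos _).trans_le hy
  have hlx := max_le_iff.1 ((Real.le_log_iff_exp_le hx0).2 hx)
  have hly := max_le_iff.1 ((Real.le_log_iff_exp_le hy0).2 hy)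
  simp only [phiStar, abs_of_nonneg hlx.2, abs_of_nonneg hly.2]
  exact hE hlx.1 hly.1 (Real.log_lt_log hx0 hxy)

theorem measurable_phiStar (k : ℕ) : Measurable (phiStar k) :=
  (Real.measurable_log.iterate k).comp Real.measurable_log.abs

theorem setAverage_Ioo_eq (g : ℝ → ℝ) {a b : ℝ} (hab : a < b) :
    ⨍ y in Ioo a b, g y = (∫ y in Ioo a b, g y) / (b - a) := by
  rw [setAverage_eq, Real.volume_real_Ioo_of_le hab.le, smul_eq_mul, inv_mul_eq_div]

section MaximalFunction

variable {f : ℝ → ℝ} {A : ℝ}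

theorem setAverage_abs_le (hf : Continuous f) (hA : ∀ x, |f x| ≤ A) {a b : ℝ} (hab : a < b) :
    ⨍ y in Ioo a b, |f y| ≤ A := by
  rw [setAverage_Ioo_eq _ hab, div_le_iff₀ (sub_pos.2 hab)]
  calc ∫ y in Ioo a b, |f y| ≤ ∫ _ in Ioo a b, A :=
        setIntegral_mono (hf.abs.integrableOn_Icc.mono_set Ioo_subset_Icc_self)
          (integrableOn_const (by simp)) hA
    _ = A * (b - a) := by
        rw [setIntegral_const, Real.volume_real_Ioo_of_le hab.le, smul_eq_mul, mul_comm]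

theorem setAverage_le_maxFun1 (hf : Continuous f) (hA : ∀ x, |f x| ≤ A) {a b x : ℝ}
    (hx : x ∈ Ioo a b) : ⨍ y in Ioo a b, |f y| ≤ maxFun1 f x := by
  refine le_csSup ⟨A, ?_⟩ ⟨a, b, hx.1.trans hx.2, hx, rfl⟩
  rintro _ ⟨p, q, hpq, -, rfl⟩
  exact setAverage_abs_le hf hA hpq

theorem maxFun1_le {x B : ℝ} (h : ∀ a b, x ∈ Ioo a b → ⨍ y in Ioo a b, |f y| ≤ B) :
    maxFun1 f x ≤ B := by
  refine csSup_le ⟨_, x - 1, x + 1, by linarith, ⟨by linarith, by linarith⟩, rfl⟩ ?_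
  rintro _ ⟨p, q, -, hx, rfl⟩
  exact h p q hx

theorem measurable_maxFun1 (hf : Continuous f) (hA : ∀ x, |f x| ≤ A) :
    Measurable (maxFun1 f) := by
  refine measurable_of_Ioi fun c => IsOpen.measurableSet (isOpen_iff_mem_nhds.2 fun x hx => ?_)
  obtain ⟨_, ⟨a, b, -, hxab, rfl⟩, hc⟩ := exists_lt_of_lt_csSup
    (by exact ⟨_, x - 1, x + 1, by linarith, ⟨by linarith, by linarith⟩, rfl⟩)
    (show c < maxFun1 f x from hx)
  filter_upwards [isOpen_Ioo.mem_nhds hxab] with y hy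
  exact hc.trans_le (setAverage_le_maxFun1 hf hA hy)

variable {ε : ℝ}

theorem maxFun1_le_of_far (hf : Continuous f) (hA : ∀ x, |f x| ≤ A)
    (hε : 0 < ε) (hsupp : ∀ x, x ∉ Ioo (-(2 * ε)) (2 * ε) → f x = 0) {x : ℝ} (hx : 9 * ε < x) :
    maxFun1 f x ≤ 4 / 7 * A := by
  have hA0 : 0 ≤ A := (abs_nonneg _).trans (hA 0)
  refine maxFun1_le fun p q hpq => ?_
  have hlt := hpq.1.trans hpq.2
  rw [setAverage_Ioo_eq _ hlt, div_le_iff₀ (sub_pos.2 hlt)]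
  have hle : ∫ y in Ioo p q, |f y| ≤
      ∫ y in Ioo p q, (Ioo (-(2 * ε)) (2 * ε)).indicator (fun _ => A) y := by
    refine setIntegral_mono (hf.abs.integrableOn_Icc.mono_set Ioo_subset_Icc_self)
      ((integrableOn_const (by simp)).indicator measurableSet_Ioo) fun y => ?_
    by_cases hy : y ∈ Ioo (-(2 * ε)) (2 * ε)
    · simpa only [indicator_of_mem hy] using hA y
    · simp [indicator_of_notMem hy, hsupp y hy]
  refine hle.trans ?_
  rw [setIntegral_indicator measurableSet_Ioo, setIntegral_const, Ioo_inter_Ioo,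
    Real.volume_real_Ioo, smul_eq_mul, mul_comm, mul_assoc, mul_left_comm]
  refine mul_le_mul_of_nonneg_left (max_le ?_ (by linarith)) hA0
  have h1 : min q (2 * ε) ≤ 2 * ε := min_le_right _ _
  have h2 : p ≤ max p (-(2 * ε)) := le_max_left _ _
  have h3 : -(2 * ε) ≤ max p (-(2 * ε)) := le_max_right _ _
  rcases le_total (2 * ε) p with h | h <;> linarith [hpq.2]

theorem maxFun1_eq_of_plateau (hf : Continuous f) (hA : ∀ x, |f x| ≤ A)
    (hplat : ∀ x ∈ Ioo (-ε) ε, |f x| = A) {x : ℝ} (hx : x ∈ Ioo (-ε) ε) :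
    maxFun1 f x = A := by
  have hlt := hx.1.trans hx.2
  refine le_antisymm (maxFun1_le fun p q hpq => setAverage_abs_le hf hA (hpq.1.trans hpq.2)) ?_
  refine le_trans (le_of_eq ?_) (setAverage_le_maxFun1 hf hA hx)
  rw [setAverage_Ioo_eq _ hlt, setIntegral_congr_fun measurableSet_Ioo hplat, setIntegral_const,
    Real.volume_real_Ioo_of_le hlt.le, smul_eq_mul, mul_div_cancel_left₀ _ (sub_pos.2 hlt).ne']

theorem le_maxFun1_of_plateau (hf : Continuous f) (hA : ∀ x, |f x| ≤ A) (hε : 0 < ε)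
    (hplat : ∀ x ∈ Ioo (-ε) ε, |f x| = A) {x : ℝ} (hx : x ∈ Ioo 0 (10 * ε)) :
    2 / 11 * A ≤ maxFun1 f x := by
  have hx' : x ∈ Ioo (-ε) (10 * ε) := ⟨by linarith [hx.1], hx.2⟩
  refine le_trans ?_ (setAverage_le_maxFun1 hf hA hx')
  rw [setAverage_Ioo_eq _ (hx'.1.trans hx'.2), le_div_iff₀ (by linarith)]
  calc 2 / 11 * A * (10 * ε - -ε) = ∫ y in Ioo (-ε) ε, |f y| := by
        rw [setIntegral_congr_fun measurableSet_Ioo hplat, setIntegral_const,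
          Real.volume_real_Ioo_of_le (by linarith), smul_eq_mul]
        ring
    _ ≤ ∫ y in Ioo (-ε) (10 * ε), |f y| :=
        setIntegral_mono_set (hf.abs.integrableOn_Icc.mono_set Ioo_subset_Icc_self)
          (ae_of_all _ fun _ => abs_nonneg _)
          (Ioo_subset_Ioo_right (by linarith)).eventuallyLE

end MaximalFunction

/-- An integrable function which equals `u` on the first tenth of an interval and is at most `v` on
the last tenth has mean deviation at least `(u - v) / 10` from any constant. -/
theorem le_setAverage_abs_sub {g : ℝ → ℝ} {ε u v : ℝ} (hε : 0 < ε) (m : ℝ)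
    (hg : IntegrableOn g (Ioo 0 (10 * ε))) (hu : ∀ x ∈ Ioo 0 ε, g x = u)
    (hv : ∀ x ∈ Ioo (9 * ε) (10 * ε), g x ≤ v) :
    (u - v) / 10 ≤ ⨍ x in Ioo 0 (10 * ε), |g x - m| := by
  have hint : IntegrableOn (fun x => |g x - m|) (Ioo 0 (10 * ε)) :=
    (hg.sub (integrableOn_const measure_Ioo_lt_top.ne)).abs
  have hs1 : Ioo 0 ε ⊆ Ioo 0 (10 * ε) := Ioo_subset_Ioo_right (by linarith)
  have hs2 : Ioo (9 * ε) (10 * ε) ⊆ Ioo 0 (10 * ε) := Ioo_subset_Ioo_left (by linarith)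
  have hconst (c : ℝ) {a b : ℝ} (hab : b - a = ε) (hs : Ioo a b ⊆ Ioo 0 (10 * ε))
      (hc : ∀ x ∈ Ioo a b, c ≤ |g x - m|) : c * ε ≤ ∫ x in Ioo a b, |g x - m| := by
    have := setIntegral_mono_on (integrableOn_const (by simp)) (hint.mono_set hs)
      measurableSet_Ioo hc
    rwa [setIntegral_const, Real.volume_real_Ioo_of_le (by linarith), hab, smul_eq_mul,
      mul_comm] at this
  have h1 := hconst (u - m) (by ring) hs1 fun x hx => by rw [hu x hx]; exact le_abs_self _
  have h2 := hconst (m - v) (by ring) hs2 fun x hx => by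
    rw [abs_sub_comm]; exact le_trans (by linarith [hv x hx]) (le_abs_self _)
  have hdisj : Disjoint (Ioo 0 ε) (Ioo (9 * ε) (10 * ε)) :=
    Set.disjoint_left.2 fun x hx hx' => by linarith [hx.2, hx'.1]
  have h3 := setIntegral_mono_set hint (ae_of_all _ fun _ => abs_nonneg _)
    (union_subset hs1 hs2).eventuallyLE
  rw [setIntegral_union hdisj measurableSet_Ioo (hint.mono_set hs1) (hint.mono_set hs2)] at h3
  rw [setAverage_Ioo_eq _ (by linarith), le_div_iff₀ (by linarith)]
  linarith

/-- Theorem A.4: failure of the Coifman–Rochberg estimate in the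
weighted spaces `bmo~_φ` with an iterated-logarithm weight, `k ≥ 1`. -/
theorem stmt_7 (k : ℕ) (hk : 1 ≤ k) :
    ∀ N > (0 : ℝ), ∀ δ ∈ Set.Ioo (0 : ℝ) 1,
      ∃ f : ℝ → ℝ, ContDiff ℝ (⊤ : ℕ∞) f ∧ HasCompactSupport f ∧
        Function.support f ⊆ Set.Icc (-1) 1 ∧
        ∃ a b : ℝ, a < b ∧ b - a < δ ∧
          N * phiW k (b - a) <
            ⨍ x in Set.Ioo a b, |phiStar k (maxFun1 f x) -
              ⨍ y in Set.Ioo a b, phiStar k (maxFun1 f y)| := by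
  intro N _ δ hδ
  obtain ⟨E, hE0, hmono⟩ := exists_strictMonoOn_phiStar k
  let A := 6 * E
  have huv : phiStar k (4 / 7 * A) < phiStar k A :=
    hmono (show E ≤ 4 / 7 * (6 * E) by linarith) (show E ≤ 6 * E by linarith)
      (show 4 / 7 * (6 * E) < 6 * E by linarith)
  have hlim : Tendsto (fun y => N * phiW k y) (𝓝[>] 0) (𝓝 0) := by
    simpa using (tendsto_phiW_zero hk).const_mul N
  obtain ⟨y, hNy, hy0, hyδ⟩ := ((hlim.eventually_lt_const
    (show 0 < (phiStar k A - phiStar k (4 / 7 * A)) / 10 by linarith)).and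
      (Ioo_mem_nhdsGT hδ.1)).exists
  obtain ⟨ε, rfl⟩ : ∃ ε, y = 10 * ε := ⟨y / 10, by ring⟩
  have hε : 0 < ε := by linarith
  let ψ : ContDiffBump (0 : ℝ) := ⟨ε, 2 * ε, hε, by linarith⟩
  let f : ℝ → ℝ := fun x => A * ψ x
  have hf : ContDiff ℝ (⊤ : ℕ∞) f := contDiff_const.mul ψ.contDiff
  have hA0 : 0 < A := by positivity
  have hsupp : ∀ x, x ∉ Ioo (-(2 * ε)) (2 * ε) → f x = 0 := fun x hx => by
    have : x ∉ Function.support ψ := by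
      rw [ψ.support_eq, Real.ball_eq_Ioo]
      simpa [ψ] using hx
    simp [f, Function.notMem_support.1 this]
  have hplat : ∀ x ∈ Ioo (-ε) ε, |f x| = A := fun x hx => by
    have : ψ x = 1 := ψ.one_of_mem_closedBall (by
      rw [Real.closedBall_eq_Icc]
      simpa [ψ] using Ioo_subset_Icc_self hx)
    simp [f, this, abs_of_pos hA0]
  have hA : ∀ x, |f x| ≤ A := fun x => by
    rw [abs_of_nonneg (mul_nonneg hA0.le ψ.nonneg)]
    exact mul_le_of_le_one_right hA0.le ψ.le_one
  refine ⟨f, hf, ψ.hasCompactSupport.mul_left, fun x hx => ?_, 0, 10 * ε, hy0, by simpa using hyδ,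
    ?_⟩
  · by_contra hx'
    refine hx (hsupp x fun h => hx' ⟨?_, ?_⟩) <;> linarith [h.1, h.2, hδ.2]
  rw [sub_zero]
  refine hNy.trans_le (le_setAverage_abs_sub hε _ ?_ (fun x hx => ?_) fun x hx => ?_)
  · refine Measure.integrableOn_of_bounded
      (M := max |phiStar k A| |phiStar k (2 / 11 * A)|) measure_Ioo_lt_top.ne
      ((measurable_phiStar k).comp (measurable_maxFun1 hf.continuous hA)).aestronglyMeasurable
      ((ae_restrict_iff' measurableSet_Ioo).2 (ae_of_all _ fun x hx => ?_))
    have hlow := le_maxFun1_of_plateau hf.continuous hA hε hplat hx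
    have hupp : maxFun1 f x ≤ A :=
      maxFun1_le fun p q hpq => setAverage_abs_le hf.continuous hA (hpq.1.trans hpq.2)
    have hEA : E ≤ 2 / 11 * A := show E ≤ 2 / 11 * (6 * E) by linarith
    rw [Real.norm_eq_abs, max_comm]
    exact abs_le_max_abs_abs (hmono.monotoneOn hEA (hEA.trans hlow) hlow)
      (hmono.monotoneOn (hEA.trans hlow) ((hEA.trans hlow).trans hupp) hupp)
  · rw [maxFun1_eq_of_plateau hf.continuous hA hplat ⟨by linarith [hx.1], hx.2⟩]
  · have hlow := le_maxFun1_of_plateau hf.continuous hA hε hplat ⟨by linarith [hx.1], hx.2⟩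
    have hEA : E ≤ 2 / 11 * A := show E ≤ 2 / 11 * (6 * E) by linarith
    exact hmono.monotoneOn (hEA.trans hlow) (show E ≤ 4 / 7 * (6 * E) by linarith)
      (maxFun1_le_of_far hf.continuous hA hε hsupp hx.1)
end

section
/- Let a < b be real numbers and let f : ℝ → ℂ be differentiable on [a,b] with f′ integrable on [a,b]. Then, writing I = [a,b] and |I| = b − a, (1/|I|)∫_I |f − f_I| ≤ (2/|I|²)∫_a^b |f′(t)|·(t−a)·(b−t) dt. -/
open MeasureTheory Set

/-- Integrating the primitive of an integrable function over an interval. -/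
theorem integral_integral_eq_integral_sub_mul {a b : ℝ} {g : ℝ → ℝ}
    (hg : IntervalIntegrable g volume a b) :
    ∫ x in a..b, ∫ t in a..x, g t = ∫ t in a..b, g t * (b - t) := by
  have hG := hg.absolutelyContinuousOnInterval_intervalIntegral (c := a) left_mem_uIcc
  have hid : AbsolutelyContinuousOnInterval (fun x : ℝ => x - b) a b :=
    (LipschitzWith.of_dist_le_mul (K := 1) (by simp)).lipschitzOnWith.absolutelyContinuousOnInterval
  have h := hG.integral_mul_deriv_eq_deriv_mul hid
  have hd : ∫ x in a..b, deriv (fun x => ∫ t in a..x, g t) x * (x - b)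
      = ∫ x in a..b, g x * (x - b) := by
    refine intervalIntegral.integral_congr_ae ?_
    filter_upwards [hg.ae_hasDerivAt_integral] with x hx hx'
    rw [(hx (uIoc_subset_uIcc hx') a left_mem_uIcc).deriv]
  rw [hd] at h
  simp only [deriv_sub_const, deriv_id'', mul_one, sub_self, mul_zero,
    intervalIntegral.integral_same, zero_mul, zero_sub] at h
  rw [h, ← intervalIntegral.integral_neg]
  congr 1 with t
  ring

/-- Integrating the complementary primitive of an integrable function over an interval. -/
theorem integral_integral_right_eq_integral_sub_mul {a b : ℝ} {g : ℝ → ℝ}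
    (hg : IntervalIntegrable g volume a b) :
    ∫ x in a..b, ∫ t in x..b, g t = ∫ t in a..b, g t * (t - a) := by
  have h := integral_integral_eq_integral_sub_mul hg.symm
  rw [intervalIntegral.integral_symm, intervalIntegral.integral_symm a b, neg_inj] at h
  have hsymm (x : ℝ) : ∫ t in x..b, g t = -∫ t in b..x, g t := intervalIntegral.integral_symm b x
  simp_rw [hsymm, intervalIntegral.integral_neg, h]
  rw [← intervalIntegral.integral_neg]
  congr 1 with t
  ring

/-- The deviation of a function from its mean, expressed through its derivative. -/
theorem smul_sub_integral_eq_integral_sub_smul_deriv {E : Type*} [NormedAddCommGroup E]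
    [NormedSpace ℝ E] [CompleteSpace E] {a b x : ℝ} {f f' : ℝ → E} (hx : x ∈ uIcc a b)
    (hf : ∀ t ∈ uIcc a b, HasDerivAt f (f' t) t) (hf' : IntervalIntegrable f' volume a b) :
    (b - a) • f x - ∫ t in a..b, f t =
      (∫ t in a..x, (t - a) • f' t) + ∫ t in x..b, (t - b) • f' t := by
  have hax : uIcc a x ⊆ uIcc a b := uIcc_subset_uIcc_left hx
  have hxb : uIcc x b ⊆ uIcc a b := uIcc_subset_uIcc_right hx
  have hfc : ContinuousOn f (uIcc a b) := fun t ht => (hf t ht).continuousAt.continuousWithinAt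
  rw [intervalIntegral.integral_smul_deriv_eq_deriv_smul (u := fun t => t - a) (u' := fun _ => 1)
      (fun t _ => (hasDerivAt_id t).sub_const a) (fun t ht => hf t (hax ht)) (by simp)
      (hf'.mono_set hax),
    intervalIntegral.integral_smul_deriv_eq_deriv_smul (u := fun t => t - b) (u' := fun _ => 1)
      (fun t _ => (hasDerivAt_id t).sub_const b) (fun t ht => hf t (hxb ht)) (by simp)
      (hf'.mono_set hxb),
    ← intervalIntegral.integral_add_adjacent_intervals (hfc.mono hax).intervalIntegrable
      (hfc.mono hxb).intervalIntegrable]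
  simp only [one_smul]
  module

/-- oscillation–derivative inequality from the proof of
Lemma A.2. -/
theorem stmt_14 (a b : ℝ) (hab : a < b) (f : ℝ → ℂ)
    (hdiff : ∀ x ∈ Set.Icc a b, DifferentiableAt ℝ f x)
    (hint : IntegrableOn (deriv f) (Set.Icc a b)) :
    ⨍ x in Set.Ioo a b, ‖f x - ⨍ y in Set.Ioo a b, f y‖ ≤
      (2 / (b - a) ^ 2) * ∫ t in Set.Ioo a b, ‖deriv f t‖ * (t - a) * (b - t) := by
  have hba : 0 < b - a := sub_pos.2 hab
  have hI : uIcc a b = Icc a b := uIcc_of_le hab.le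
  have hvol : volume.real (Ioo a b) = b - a := Real.volume_real_Ioo_of_le hab.le
  have hf' : IntervalIntegrable (deriv f) volume a b :=
    (intervalIntegrable_iff_integrableOn_Icc_of_le hab.le).2 hint
  have hfc : ContinuousOn f (uIcc a b) := fun t ht =>
    (hdiff t (hI ▸ ht)).continuousAt.continuousWithinAt
  rw [setAverage_eq, setAverage_eq, hvol]
  simp_rw [← integral_Ioc_eq_integral_Ioo, ← intervalIntegral.integral_of_le hab.le]
  have hl : IntervalIntegrable (fun t => ‖deriv f t‖ * (t - a)) volume a b :=
    hf'.norm.mul_continuousOn (by fun_prop)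
  have hr : IntervalIntegrable (fun t => ‖deriv f t‖ * (b - t)) volume a b :=
    hf'.norm.mul_continuousOn (by fun_prop)
  have hL : IntervalIntegrable (fun x => ∫ t in a..x, ‖deriv f t‖ * (t - a)) volume a b :=
    (intervalIntegral.continuousOn_primitive_interval' hl left_mem_uIcc).intervalIntegrable
  have hR : IntervalIntegrable (fun x => ∫ t in x..b, ‖deriv f t‖ * (b - t)) volume a b := by
    simp_rw [intervalIntegral.integral_symm b]
    exact (intervalIntegral.continuousOn_primitive_interval' hr
      right_mem_uIcc).neg.intervalIntegrable
  have hpt : ∀ x ∈ Icc a b, (b - a) * ‖f x - (b - a)⁻¹ • ∫ y in a..b, f y‖ ≤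
      (∫ t in a..x, ‖deriv f t‖ * (t - a)) + ∫ t in x..b, ‖deriv f t‖ * (b - t) := by
    intro x hx
    rw [← Real.norm_of_nonneg hba.le, ← norm_smul, Real.norm_of_nonneg hba.le, smul_sub,
      smul_inv_smul₀ hba.ne', smul_sub_integral_eq_integral_sub_smul_deriv (hI ▸ hx)
        (fun t ht => (hdiff t (hI ▸ ht)).hasDerivAt) hf']
    refine (norm_add_le _ _).trans (add_le_add ?_ ?_)
    · refine (intervalIntegral.norm_integral_le_integral_norm hx.1).trans_eq
        (intervalIntegral.integral_congr fun t ht => ?_)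
      rw [uIcc_of_le hx.1] at ht
      simp only [norm_smul, Real.norm_of_nonneg (sub_nonneg.2 ht.1), mul_comm]
    · refine (intervalIntegral.norm_integral_le_integral_norm hx.2).trans_eq
        (intervalIntegral.integral_congr fun t ht => ?_)
      rw [uIcc_of_le hx.2] at ht
      simp only [norm_smul, Real.norm_of_nonpos (sub_nonpos.2 ht.2), neg_sub, mul_comm]
  have key := intervalIntegral.integral_mono_on hab.le
    ((hfc.sub continuousOn_const).norm.intervalIntegrable.const_mul (b - a)) (hL.add hR) hpt
  rw [intervalIntegral.integral_const_mul, intervalIntegral.integral_add hL hR,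
    integral_integral_eq_integral_sub_mul hl,
    integral_integral_right_eq_integral_sub_mul hr] at key
  simp_rw [mul_right_comm _ (b - _), ← two_mul, Pi.sub_apply] at key
  rw [smul_eq_mul, inv_mul_eq_div, div_mul_eq_mul_div, div_le_div_iff₀ hba (by positivity)]
  nlinarith [mul_le_mul_of_nonneg_right key hba.le]
end

section
/- Let T > 0 and let f : (0,T) → ℝ be differentiable and antitone (decreasing) on (0,T) and integrable on (0,T). Let α ∈ (0,T) satisfy f(α) = (1/T)∫_0^T f(x) dx. Then ∫_0^T |f(x) − f(α)| dx = ∫_0^α t·|f′(t)| dt + ∫_α^T (T−t)·|f′(t)| dt. -/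
open MeasureTheory Set

theorem AntitoneOn.mul_le_intervalIntegral {h : ℝ → ℝ} {a x : ℝ} (hanti : AntitoneOn h (Ioc 0 a))
    (hint : IntervalIntegrable h volume 0 a) (hx : x ∈ Icc 0 a) :
    x * h x ≤ ∫ t in (0 : ℝ)..x, h t := by
  have hsub : IntervalIntegrable h volume 0 x :=
    hint.mono_set (by
      rw [uIcc_of_le hx.1, uIcc_of_le (hx.1.trans hx.2)]
      exact Icc_subset_Icc_right hx.2)
  have := intervalIntegral.integral_mono_on_of_le_Ioo hx.1
    (intervalIntegrable_const (c := h x)) hsub fun t ht =>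
      hanti ⟨ht.1, ht.2.le.trans hx.2⟩ ⟨ht.1.trans ht.2, hx.2⟩ ht.2.le
  simpa using this

theorem AntitoneOn.deriv_nonpos_of_mem_Ioo {h : ℝ → ℝ} {a b x : ℝ} (hanti : AntitoneOn h (Ioo a b))
    (hx : x ∈ Ioo a b) : deriv h x ≤ 0 := by
  rw [← derivWithin_of_isOpen isOpen_Ioo hx]
  exact hanti.derivWithin_nonpos

/-- Integration by parts for a decreasing function, possibly unbounded at `0`, that vanishes
at `a`. -/
theorem AntitoneOn.integral_eq_integral_mul_abs_deriv {h : ℝ → ℝ} {a : ℝ} (ha : 0 < a)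
    (hdiff : ∀ x ∈ Ioc 0 a, DifferentiableAt ℝ h x) (hanti : AntitoneOn h (Ioc 0 a))
    (hint : IntervalIntegrable h volume 0 a) (hzero : h a = 0) :
    ∫ t in (0 : ℝ)..a, h t = ∫ t in (0 : ℝ)..a, t * |deriv h t| := by
  have hderiv_nonpos : ∀ x ∈ Ioo 0 a, deriv h x ≤ 0 := fun x hx =>
    (hanti.mono Ioo_subset_Ioc_self).deriv_nonpos_of_mem_Ioo hx
  have hprim : ContinuousOn (fun x => ∫ t in (0 : ℝ)..x, h t) (Icc 0 a) := by
    have := intervalIntegral.continuousOn_primitive_interval' hint left_mem_uIcc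
    rwa [uIcc_of_le ha.le] at this
  have hmul : ContinuousOn (fun x => x * h x) (Icc 0 a) := by
    intro x hx
    rcases hx.1.eq_or_lt with rfl | hx0
    · have hlim := hprim 0 hx
      unfold ContinuousWithinAt at hlim ⊢
      simp only [intervalIntegral.integral_same] at hlim
      simp only [zero_mul]
      refine tendsto_of_tendsto_of_tendsto_of_le_of_le' tendsto_const_nhds hlim ?_ ?_
      · filter_upwards [self_mem_nhdsWithin] with y hy
        rcases hy.1.eq_or_lt with rfl | hy0
        · simp
        · have : h a ≤ h y := hanti ⟨hy0, hy.2⟩ ⟨ha, le_rfl⟩ hy.2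
          exact mul_nonneg hy.1 (hzero ▸ this)
      · filter_upwards [self_mem_nhdsWithin] with y hy
        exact hanti.mul_le_intervalIntegral hint hy
    · exact (continuousAt_id.mul (hdiff x ⟨hx0, hx.2⟩).continuousAt).continuousWithinAt
  have hcont : ContinuousOn (fun x => (∫ t in (0 : ℝ)..x, h t) - x * h x) (Icc 0 a) :=
    hprim.sub hmul
  have hderiv : ∀ x ∈ Ioo 0 a,
      HasDerivAt (fun x => (∫ t in (0 : ℝ)..x, h t) - x * h x) (x * |deriv h x|) x := by
    intro x hx
    have hh := (hdiff x ⟨hx.1, hx.2.le⟩).hasDerivAt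
    have hcontOn : ContinuousOn h (Ioo 0 a) := fun y hy =>
      (hdiff y ⟨hy.1, hy.2.le⟩).continuousAt.continuousWithinAt
    have hsub : IntervalIntegrable h volume 0 x :=
      hint.mono_set (by
        rw [uIcc_of_le hx.1.le, uIcc_of_le ha.le]
        exact Icc_subset_Icc_right hx.2.le)
    have := (intervalIntegral.integral_hasDerivAt_right hsub
      (hcontOn.stronglyMeasurableAtFilter isOpen_Ioo x hx) hh.continuousAt).sub
      ((hasDerivAt_id x).mul hh)
    refine this.congr_deriv ?_
    rw [abs_of_nonpos (hderiv_nonpos x hx)]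
    simp
  have hpos : ∀ x ∈ Ioo 0 a, 0 ≤ x * |deriv h x| := fun x hx =>
    mul_nonneg hx.1.le (abs_nonneg _)
  have hii : IntervalIntegrable (fun x => x * |deriv h x|) volume 0 a :=
    intervalIntegral.intervalIntegrable_deriv_of_nonneg (by rwa [uIcc_of_le ha.le])
      (by simpa [ha.le] using hderiv) (by simpa [ha.le] using hpos)
  rw [intervalIntegral.integral_eq_sub_of_hasDerivAt_of_le ha.le hcont hderiv hii]
  simp [hzero]

/-- exact decomposition of the mean oscillation of a decreasing
function, from the proof of Lemma A.3. -/
theorem stmt_15 (T : ℝ) (hT : 0 < T) (f : ℝ → ℝ)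
    (hdiff : ∀ x ∈ Set.Ioo 0 T, DifferentiableAt ℝ f x)
    (hanti : AntitoneOn f (Set.Ioo 0 T))
    (hint : IntegrableOn f (Set.Ioo 0 T))
    (α : ℝ) (hα : α ∈ Set.Ioo 0 T)
    (hmean : f α = (1 / T) * ∫ x in Set.Ioo 0 T, f x) :
    ∫ x in Set.Ioo 0 T, |f x - f α| =
      (∫ t in Set.Ioo 0 α, t * |deriv f t|) +
        ∫ t in Set.Ioo α T, (T - t) * |deriv f t| := by
  have hfi : IntervalIntegrable f volume 0 T :=
    (intervalIntegrable_iff_integrableOn_Ioo_of_le hT.le).2 hint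
  have hαmem : α ∈ uIcc 0 T := by rw [uIcc_of_le hT.le]; exact Ioo_subset_Icc_self hα
  have hfl : IntervalIntegrable f volume 0 α := hfi.mono_set (uIcc_subset_uIcc_left hαmem)
  have hfr : IntervalIntegrable f volume α T := hfi.mono_set (uIcc_subset_uIcc_right hαmem)
  have hleft : ∫ t in (0 : ℝ)..α, |f t - f α| = ∫ t in (0 : ℝ)..α, t * |deriv f t| := by
    have key := AntitoneOn.integral_eq_integral_mul_abs_deriv (h := fun t => f t - f α) hα.1
      (fun x hx => (hdiff x ⟨hx.1, hx.2.trans_lt hα.2⟩).sub_const _)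
      (fun x hx y hy hxy => sub_le_sub_right
        (hanti ⟨hx.1, hx.2.trans_lt hα.2⟩ ⟨hy.1, hy.2.trans_lt hα.2⟩ hxy) _)
      (hfl.sub intervalIntegrable_const) (sub_self _)
    simp only [deriv_sub_const] at key
    rw [← key, intervalIntegral.integral_of_le hα.1.le, intervalIntegral.integral_of_le hα.1.le]
    refine setIntegral_congr_fun measurableSet_Ioc fun x hx => ?_
    exact abs_of_nonneg (sub_nonneg.2 (hanti ⟨hx.1, hx.2.trans_lt hα.2⟩ hα hx.2))
  have hright : ∫ t in α..T, |f t - f α| = ∫ t in α..T, (T - t) * |deriv f t| := by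
    have hmaps : ∀ x ∈ Ioc 0 (T - α), T - x ∈ Ioo 0 T := fun x hx =>
      ⟨by linarith [hx.2, hα.1], by linarith [hx.1]⟩
    have key := AntitoneOn.integral_eq_integral_mul_abs_deriv (h := fun t => f α - f (T - t))
      (sub_pos.2 hα.2)
      (fun x hx => ((differentiableAt_comp_const_sub (f := f)).2
        (hdiff _ (hmaps x hx))).const_sub _)
      (fun x hx y hy hxy => sub_le_sub_left
        (hanti (hmaps y hy) (hmaps x hx) (sub_le_sub_left hxy _)) _)
      (intervalIntegrable_const.sub (by simpa using (hfr.comp_sub_left T).symm)) (by simp)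
    simp only [deriv_const_sub, deriv_comp_const_sub, neg_neg] at key
    rw [intervalIntegral.integral_comp_sub_left (fun t => f α - f t) T] at key
    have hrefl := intervalIntegral.integral_comp_sub_left
      (a := 0) (b := T - α) (fun t => (T - t) * |deriv f t|) T
    simp only [sub_sub_cancel, sub_zero] at key hrefl
    rw [← hrefl, ← key, intervalIntegral.integral_of_le hα.2.le,
      intervalIntegral.integral_of_le hα.2.le, integral_Ioc_eq_integral_Ioo,
      integral_Ioc_eq_integral_Ioo]
    refine setIntegral_congr_fun measurableSet_Ioo fun x hx => ?_
    have : f x ≤ f α := hanti hα ⟨hα.1.trans hx.1, hx.2⟩ hx.1.le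
    simp only [abs_of_nonpos (sub_nonpos.2 this), neg_sub]
  simp only [← integral_Ioc_eq_integral_Ioo]
  rw [← intervalIntegral.integral_of_le hT.le, ← intervalIntegral.integral_of_le hα.1.le,
    ← intervalIntegral.integral_of_le hα.2.le, ← hleft, ← hright]
  exact (intervalIntegral.integral_add_adjacent_intervals
    (hfl.sub intervalIntegrable_const).abs (hfr.sub intervalIntegrable_const).abs).symm
end
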